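/- Let λ ≤ 0 and let f : (a,b) → ℝ, (a,b) ⊂ (0,∞), be a right maximally extended C² solution of f''/(1+(f')²) = (r − (n−1)/r)·f' − f − λ·√(1+(f')²) with f' > 0 and f'' > 0 on (a,b). Then b > C_λ, where C_λ = (λ + √(λ² + 4(n−1)))/2. -/

import Mathlib

/-- `g` is a C² solution of `f''/(1+(f')²) = (r − (n−1)/r)f' − f − λ√(1+(f')²)` on `(a,b)`. -/
def IsProfileSol (n : ℕ) (lam a b : ℝ) (g : ℝ → ℝ) : Prop :=
  (∀ r ∈ Set.Ioo a b, DifferentiableAt ℝ g r ∧ DifferentiableAt ℝ (deriv g) r) ∧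
  ∀ r ∈ Set.Ioo a b,
    deriv (deriv g) r / (1 + (deriv g r) ^ 2) =
      (r - ((n : ℝ) - 1) / r) * deriv g r - g r - lam * Real.sqrt (1 + (deriv g r) ^ 2)

open Set Filter Topology

/-- An integral curve of `V` on `(a, b)` that converges at `b` to a point near which `V` is `C¹`
extends to an integral curve on some `(a, b')` with `b' > b`. -/
theorem exists_extend_integralCurve {E : Type*} [NormedAddCommGroup E] [NormedSpace ℝ E]
    [CompleteSpace E] {V : E → E} {y : ℝ → E} {y₀ : E} {a b : ℝ} (hab : a < b)
    (hV : ContDiffAt ℝ 1 V y₀) (hy : ∀ t ∈ Ioo a b, HasDerivAt y (V (y t)) t)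
    (hlim : Tendsto y (𝓝[<] b) (𝓝 y₀)) :
    ∃ b' > b, ∃ z : ℝ → E, EqOn z y (Ioo a b) ∧
      ∀ t ∈ Ioo a b', HasDerivAt z (V (z t)) t := by
  obtain ⟨α, hα0, ε, hε, hα⟩ :=
    hV.exists_forall_mem_closedBall_exists_eq_forall_mem_Ioo_hasDerivAt₀ b
  let z : ℝ → E := fun t => if t < b then y t else α t
  have hzl : ∀ t, t < b → z t = y t := fun t ht => if_pos ht
  have hzr : ∀ t, b ≤ t → z t = α t := fun t ht => if_neg ht.not_gt
  have hderiv_left : ∀ t ∈ Ioo a b, HasDerivAt z (V (z t)) t := by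
    intro t ht
    rw [hzl t ht.2]
    refine (hy t ht).congr_of_eventuallyEq ?_
    filter_upwards [Iio_mem_nhds ht.2] with s hs using hzl s hs
  refine ⟨b + ε, by linarith, z, fun t ht => hzl t ht.2, fun t ht => ?_⟩
  rcases lt_trichotomy t b with h | rfl | h
  · exact hderiv_left t ⟨ht.1, h⟩
  · have hzt : z t = y₀ := (hzr t le_rfl).trans hα0
    have hzlim : Tendsto z (𝓝[<] t) (𝓝 y₀) := by
      refine hlim.congr' ?_
      filter_upwards [self_mem_nhdsWithin] with s hs using (hzl s hs).symm
    have hleft : HasDerivWithinAt z (V y₀) (Iic t) t := by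
      refine hasDerivWithinAt_Iic_of_tendsto_deriv (s := Ioo a t)
        (fun s hs => (hderiv_left s hs).differentiableAt.differentiableWithinAt) ?_
        (Ioo_mem_nhdsLT hab) ?_
      · rw [ContinuousWithinAt, hzt]
        exact hzlim.mono_left (nhdsWithin_mono _ Ioo_subset_Iio_self)
      · refine (hV.continuousAt.tendsto.comp hzlim).congr' ?_
        filter_upwards [Ioo_mem_nhdsLT hab] with s hs using (hderiv_left s hs).deriv.symm
    have hright : HasDerivWithinAt z (V y₀) (Ici t) t := by
      have h := (hα t ⟨by linarith, by linarith⟩).hasDerivWithinAt (s := Ici t)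
      rw [hα0] at h
      exact h.congr (fun s hs => hzr s hs) (hzr t le_rfl)
    have h := hleft.union hright
    rw [Iic_union_Ici, hasDerivWithinAt_univ] at h
    rwa [hzt]
  · rw [hzr t h.le]
    refine (hα t ⟨by linarith, ht.2⟩).congr_of_eventuallyEq ?_
    filter_upwards [Ioi_mem_nhds h] with s hs using hzr s (mem_Ioi.mp hs).le

/-- The phase-space vector field on `(r, f, f')` of the profile equation. -/
noncomputable def profileField (n : ℕ) (lam : ℝ) (q : ℝ × ℝ × ℝ) : ℝ × ℝ × ℝ :=
  (1, q.2.2, (1 + q.2.2 ^ 2) *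
    ((q.1 - ((n : ℝ) - 1) / q.1) * q.2.2 - q.2.1 - lam * Real.sqrt (1 + q.2.2 ^ 2)))

theorem contDiffAt_profileField (n : ℕ) (lam : ℝ) {q : ℝ × ℝ × ℝ} (hq : q.1 ≠ 0) :
    ContDiffAt ℝ 1 (profileField n lam) q := by
  have hs : (1 : ℝ) + q.2.2 ^ 2 ≠ 0 := by positivity
  unfold profileField
  fun_prop (disch := assumption)

theorem IsProfileSol.hasDerivAt_profileField {n : ℕ} {lam a b : ℝ} {f : ℝ → ℝ}
    (hsol : IsProfileSol n lam a b f) {r : ℝ} (hr : r ∈ Ioo a b) :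
    HasDerivAt (fun t => (t, f t, deriv f t)) (profileField n lam (r, f r, deriv f r)) r := by
  have hode := hsol.2 r hr
  rw [div_eq_iff (by positivity), mul_comm] at hode
  have h := (hasDerivAt_id r).prodMk
    ((hsol.1 r hr).1.hasDerivAt.prodMk (hsol.1 r hr).2.hasDerivAt)
  rw [hode] at h
  exact h

/-- A profile solution on `(a, b)` such that it and its derivative converge at `b > 0` extends
beyond `b`. -/
theorem IsProfileSol.exists_extend {n : ℕ} {lam a b L P : ℝ} {f : ℝ → ℝ} (hab : a < b)
    (hb : 0 < b) (hsol : IsProfileSol n lam a b f) (hL : Tendsto f (𝓝[<] b) (𝓝 L))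
    (hP : Tendsto (deriv f) (𝓝[<] b) (𝓝 P)) :
    ∃ b' > b, ∃ g : ℝ → ℝ, IsProfileSol n lam a b' g ∧ EqOn g f (Ioo a b) := by
  have hid : Tendsto (fun t : ℝ => t) (𝓝[<] b) (𝓝 b) := tendsto_id.mono_left nhdsWithin_le_nhds
  obtain ⟨b', hb', z, hzf, hz⟩ := exists_extend_integralCurve hab
    (contDiffAt_profileField n lam (q := (b, L, P)) hb.ne')
    (fun t ht => hsol.hasDerivAt_profileField ht) (hid.prodMk_nhds (hL.prodMk_nhds hP))
  have h1 : ∀ t ∈ Ioo a b', HasDerivAt (fun s => (z s).1) 1 t := fun t ht => (hz t ht).fst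
  have h2 : ∀ t ∈ Ioo a b', HasDerivAt (fun s => (z s).2.1) (z t).2.2 t :=
    fun t ht => (hz t ht).snd.fst
  have h3 : ∀ t ∈ Ioo a b', HasDerivAt (fun s => (z s).2.2) (profileField n lam (z t)).2.2 t :=
    fun t ht => (hz t ht).snd.snd
  have htime : EqOn (fun s => (z s).1) (fun s => s) (Ioo a b') := by
    obtain ⟨c, hc⟩ := nonempty_Ioo.mpr hab
    refine isOpen_Ioo.eqOn_of_deriv_eq isPreconnected_Ioo
      (fun t ht => (h1 t ht).differentiableAt.differentiableWithinAt) differentiableOn_id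
      (fun t ht => ?_) (x := c) ⟨hc.1, hc.2.trans hb'⟩ ?_
    · rw [(h1 t ht).deriv, deriv_id'']
    · rw [hzf hc]
  have hderiv : ∀ t ∈ Ioo a b', deriv (fun s => (z s).2.1) =ᶠ[𝓝 t] fun s => (z s).2.2 := by
    intro t ht
    filter_upwards [isOpen_Ioo.mem_nhds ht] with s hs using (h2 s hs).deriv
  refine ⟨b', hb', fun s => (z s).2.1, ⟨fun t ht => ⟨(h2 t ht).differentiableAt,
    ((h3 t ht).congr_of_eventuallyEq (hderiv t ht)).differentiableAt⟩, fun t ht => ?_⟩,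
    fun t ht => congrArg (fun q => q.2.1) (hzf ht)⟩
  have ht1 : (z t).1 = t := htime ht
  rw [((h3 t ht).congr_of_eventuallyEq (hderiv t ht)).deriv, (hderiv t ht).eq_of_nhds,
    div_eq_iff (by positivity), profileField, ht1, mul_comm]

theorem Real.sqrt_one_add_sq_sub_le_one {p : ℝ} (hp : 0 ≤ p) : √(1 + p ^ 2) - p ≤ 1 := by
  have : √(1 + p ^ 2) ≤ 1 + p := Real.sqrt_le_iff.mpr ⟨by linarith, by nlinarith⟩
  linarith

/-- Below `C_λ` the coefficient `r - (n - 1) / r` is at most `λ`. -/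
theorem sub_div_le_of_lt_profileConst {n : ℕ} {lam r : ℝ} (hlam : lam ≤ 0) (hr : 0 < r)
    (h : r < (lam + Real.sqrt (lam ^ 2 + 4 * ((n : ℝ) - 1))) / 2) :
    r - ((n : ℝ) - 1) / r ≤ lam := by
  have hsq := (Real.lt_sqrt (by linarith : 0 ≤ 2 * r - lam)).mp
    (by linarith : 2 * r - lam < Real.sqrt (lam ^ 2 + 4 * ((n : ℝ) - 1)))
  have : r - lam ≤ ((n : ℝ) - 1) / r := by
    rw [le_div_iff₀ hr]
    nlinarith
  linarith

/-- If `p = f'` is nonnegative and `p' ≤ M (1 + p²)` with `f` bounded above, then `p` is bounded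
above, since `log (1 + p²) - 2 M f` is nonincreasing. -/
theorem exists_forall_le_of_deriv_le_mul_one_add_sq {f p p' : ℝ → ℝ} {c b K M : ℝ}
    (hf : ∀ r ∈ Ico c b, HasDerivAt f (p r) r) (hp : ∀ r ∈ Ico c b, HasDerivAt p (p' r) r)
    (hp0 : ∀ r ∈ Ico c b, 0 ≤ p r) (hM : 0 ≤ M) (hK : ∀ r ∈ Ico c b, f r ≤ K)
    (hle : ∀ r ∈ Ico c b, p' r ≤ M * (1 + p r ^ 2)) :
    ∃ B, ∀ r ∈ Ico c b, p r ≤ B := by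
  let h : ℝ → ℝ := fun r => Real.log (1 + p r ^ 2) - 2 * M * f r
  have hh : ∀ r ∈ Ico c b,
      HasDerivAt h (2 * p r * p' r / (1 + p r ^ 2) - 2 * M * p r) r := by
    intro r hr
    have hsq : HasDerivAt (fun s => 1 + p s ^ 2) (2 * p r * p' r) r := by
      simpa using ((hp r hr).pow 2).const_add 1
    exact (hsq.log (by positivity)).sub ((hf r hr).const_mul _)
  have hanti : AntitoneOn h (Ico c b) := by
    refine antitoneOn_of_deriv_nonpos (convex_Ico c b)
      (fun r hr => (hh r hr).continuousAt.continuousWithinAt)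
      (fun r hr => (hh r (interior_subset hr)).differentiableAt.differentiableWithinAt)
      (fun r hr => ?_)
    replace hr := interior_subset hr
    rw [(hh r hr).deriv, sub_nonpos, div_le_iff₀ (by positivity)]
    nlinarith [mul_le_mul_of_nonneg_left (hle r hr) (hp0 r hr)]
  refine ⟨Real.exp (h c + 2 * M * K), fun r hr => ?_⟩
  have hlog : Real.log (1 + p r ^ 2) ≤ h c + 2 * M * K := by
    have h1 : Real.log (1 + p r ^ 2) - 2 * M * f r ≤ h c :=
      hanti ⟨le_rfl, hr.1.trans_lt hr.2⟩ hr hr.1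
    nlinarith [mul_le_mul_of_nonneg_left (hK r hr) hM]
  have := (Real.log_le_iff_le_exp (by positivity)).mp hlog
  nlinarith [sq_nonneg (p r - 1)]

/-- A function that is increasing on `(a, b)` and bounded above near `b` converges at `b`. -/
theorem exists_tendsto_nhdsLT_of_deriv_pos {g : ℝ → ℝ} {a b c B : ℝ} (hc : c ∈ Ioo a b)
    (hg : ∀ r ∈ Ioo a b, 0 < deriv g r) (hB : ∀ r ∈ Ico c b, g r ≤ B) :
    ∃ L, Tendsto g (𝓝[<] b) (𝓝 L) := by
  have hsub : Ioo c b ⊆ Ioo a b := Ioo_subset_Ioo_left hc.1.le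
  have hmono : StrictMonoOn g (Ioo c b) := strictMonoOn_of_deriv_pos (convex_Ioo c b)
    (fun r hr =>
      (differentiableAt_of_deriv_ne_zero (hg r (hsub hr)).ne').continuousAt.continuousWithinAt)
    (fun r hr => hg r (hsub (interior_subset hr)))
  refine ⟨_, hmono.monotoneOn.tendsto_nhdsWithin_Ioo_left (nonempty_Ioo.mpr hc.2) ⟨B, ?_⟩⟩
  rintro _ ⟨r, hr, rfl⟩
  exact hB r (Ioo_subset_Ico_self hr)

/-- For `λ ≤ 0`, a right maximally extended solution with `f' > 0` and `f'' > 0` on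
`(a,b) ⊂ (0,∞)` satisfies `b > C_λ = (λ + √(λ² + 4(n−1)))/2`. -/
theorem stmt_9 (n : ℕ) (hn : 2 ≤ n) (lam a b : ℝ) (hlam : lam ≤ 0)
    (ha : 0 ≤ a) (hab : a < b)
    (f : ℝ → ℝ)
    (hsol : IsProfileSol n lam a b f)
    (hmax : ∀ b' : ℝ, b < b' →
      ¬ ∃ g : ℝ → ℝ, IsProfileSol n lam a b' g ∧ Set.EqOn g f (Set.Ioo a b))
    (hf' : ∀ r ∈ Set.Ioo a b, 0 < deriv f r)
    (hf'' : ∀ r ∈ Set.Ioo a b, 0 < deriv (deriv f) r) :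
    (lam + Real.sqrt (lam ^ 2 + 4 * ((n : ℝ) - 1))) / 2 < b := by
  by_contra! hb
  have hb0 : 0 < b := ha.trans_lt hab
  obtain ⟨c, hc⟩ := nonempty_Ioo.mpr hab
  have hsub : Ico c b ⊆ Ioo a b := fun r hr => ⟨hc.1.trans_le hr.1, hr.2⟩
  have hcoef : ∀ r ∈ Ioo a b, r - ((n : ℝ) - 1) / r ≤ lam := fun r hr =>
    sub_div_le_of_lt_profileConst hlam (ha.trans_lt hr.1) (hr.2.trans_le hb)
  have hode : ∀ r ∈ Ioo a b, deriv (deriv f) r / (1 + (deriv f r) ^ 2) ≤ -lam - f r := by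
    intro r hr
    rw [hsol.2 r hr]
    have hp := hf' r hr
    have h1 := mul_le_mul_of_nonneg_right (hcoef r hr) hp.le
    have h2 := mul_le_mul_of_nonneg_left (Real.sqrt_one_add_sq_sub_le_one hp.le)
      (neg_nonneg.mpr hlam)
    linarith
  have hf_le : ∀ r ∈ Ico c b, f r ≤ -lam := by
    intro r hr
    have h0 : 0 < deriv (deriv f) r / (1 + (deriv f r) ^ 2) :=
      div_pos (hf'' r (hsub hr)) (by positivity)
    linarith [hode r (hsub hr)]
  have hmono : StrictMonoOn f (Ioo a b) := strictMonoOn_of_deriv_pos (convex_Ioo a b)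
    (fun r hr => (hsol.1 r hr).1.continuousAt.continuousWithinAt)
    (fun r hr => hf' r (interior_subset hr))
  have hf''_le : ∀ r ∈ Ico c b,
      deriv (deriv f) r ≤ (-lam - f c) * (1 + (deriv f r) ^ 2) := by
    intro r hr
    rw [← div_le_iff₀ (by positivity)]
    linarith [hode r (hsub hr), hmono.monotoneOn hc (hsub hr) hr.1]
  obtain ⟨B, hB⟩ := exists_forall_le_of_deriv_le_mul_one_add_sq
    (fun r hr => (hsol.1 r (hsub hr)).1.hasDerivAt)
    (fun r hr => (hsol.1 r (hsub hr)).2.hasDerivAt)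
    (fun r hr => (hf' r (hsub hr)).le) (by linarith [hf_le c ⟨le_rfl, hc.2⟩]) hf_le hf''_le
  obtain ⟨L, hL⟩ := exists_tendsto_nhdsLT_of_deriv_pos hc hf' hf_le
  obtain ⟨P, hP⟩ := exists_tendsto_nhdsLT_of_deriv_pos hc hf'' hB
  obtain ⟨b', hb', g, hg⟩ := hsol.exists_extend hab hb0 hL hP
  exact hmax b' hb' ⟨g, hg⟩
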